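/- arXiv:2505.19471 — 3 statements merged into one kernel-verified Lean document; each statement's English description precedes it below -/
import Mathlib

section
/- Let p ∈ [1, ∞), let n, d ≥ 1 be integers, and let 𝐚 be a complex (nd)×d matrix. Then the p-operator norm of 𝐚 equals the supremum of the p-operator norms ‖b𝐚‖_p over all complex d×(nd) matrices b with p-operator norm at most 1; moreover this supremum is attained. (This is the first C*-likeness condition for the row-column module over A = M_d^p(ℂ).) -/
open scoped ENNReal

/-- The `(p → q)`-operator norm of a complex matrix, i.e. its norm as a linear
operator from `ℓ^p` to `ℓ^q` (finite-dimensional). -/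
noncomputable def opNorm (p q : ℝ≥0∞) [Fact (1 ≤ p)] [Fact (1 ≤ q)]
    {ι κ : Type*} [Fintype ι] [Fintype κ] (a : Matrix ι κ ℂ) : ℝ :=
  ‖LinearMap.toContinuousLinearMap
    (((WithLp.linearEquiv q ℂ (ι → ℂ)).symm.toLinearMap.comp
      a.mulVecLin).comp (WithLp.linearEquiv p ℂ (κ → ℂ)).toLinearMap)‖

/-- A continuous linear map on a finite-dimensional space attains its norm on the unit ball. -/
theorem ContinuousLinearMap.exists_norm_le_one_norm_apply_eq {E F : Type*}
    [NormedAddCommGroup E] [NormedSpace ℂ E] [FiniteDimensional ℂ E]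
    [NormedAddCommGroup F] [NormedSpace ℂ F] (T : E →L[ℂ] F) :
    ∃ x : E, ‖x‖ ≤ 1 ∧ ‖T x‖ = ‖T‖ := by
  have : ProperSpace E := FiniteDimensional.proper ℂ E
  obtain ⟨x, hx, hmax⟩ := (isCompact_closedBall (0 : E) 1).exists_isMaxOn
    (Metric.nonempty_closedBall.2 zero_le_one) T.continuous.norm.continuousOn
  have hx1 : ‖x‖ ≤ 1 := mem_closedBall_zero_iff.1 hx
  refine ⟨x, hx1, le_antisymm (T.unit_le_opNorm x hx1) ?_⟩
  rw [← T.sSup_unitClosedBall_eq_norm]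
  refine csSup_le ((Metric.nonempty_closedBall.2 zero_le_one).image _) ?_
  rintro _ ⟨y, hy, rfl⟩
  exact hmax hy

/-- A matrix as a continuous linear map between finite-dimensional `ℓ^p` spaces. -/
noncomputable def Matrix.toLpCLM (p q : ℝ≥0∞) [Fact (1 ≤ p)] [Fact (1 ≤ q)]
    {ι κ : Type*} [Fintype ι] [Fintype κ] (a : Matrix ι κ ℂ) :
    PiLp p (fun _ : κ => ℂ) →L[ℂ] PiLp q (fun _ : ι => ℂ) :=
  LinearMap.toContinuousLinearMap
    (((WithLp.linearEquiv q ℂ (ι → ℂ)).symm.toLinearMap.comp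
      a.mulVecLin).comp (WithLp.linearEquiv p ℂ (κ → ℂ)).toLinearMap)

section

variable {p q r : ℝ≥0∞} [Fact (1 ≤ p)] [Fact (1 ≤ q)] [Fact (1 ≤ r)]
  {ι κ μ : Type*} [Fintype ι] [Fintype κ] [Fintype μ]

theorem opNorm_eq_norm_toLpCLM (a : Matrix ι κ ℂ) : opNorm p q a = ‖a.toLpCLM p q‖ := rfl

theorem Matrix.toLpCLM_apply (a : Matrix ι κ ℂ) (x : PiLp p (fun _ : κ => ℂ)) :
    a.toLpCLM p q x = WithLp.toLp q (a.mulVec x.ofLp) := rfl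

theorem Matrix.toLpCLM_mul (b : Matrix ι κ ℂ) (a : Matrix κ μ ℂ) :
    (b * a).toLpCLM p r = (b.toLpCLM q r).comp (a.toLpCLM p q) := by
  ext x : 1
  simp [Matrix.toLpCLM_apply, Matrix.mulVec_mulVec]

theorem Matrix.exists_toLpCLM_eq
    (T : PiLp p (fun _ : κ => ℂ) →L[ℂ] PiLp q (fun _ : ι => ℂ)) :
    ∃ a : Matrix ι κ ℂ, a.toLpCLM p q = T := by
  classical
  refine ⟨LinearMap.toMatrix' (((WithLp.linearEquiv q ℂ (ι → ℂ)).toLinearMap.comp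
    T.toLinearMap).comp (WithLp.linearEquiv p ℂ (κ → ℂ)).symm.toLinearMap), ?_⟩
  ext x : 1
  simp [Matrix.toLpCLM_apply, LinearMap.toMatrix'_mulVec]

theorem opNorm_mul_le (b : Matrix ι κ ℂ) (a : Matrix κ μ ℂ) :
    opNorm p r (b * a) ≤ opNorm q r b * opNorm p q a := by
  simp only [opNorm_eq_norm_toLpCLM, Matrix.toLpCLM_mul (q := q)]
  exact ContinuousLinearMap.opNorm_comp_le _ _

/-- The operator norm of a matrix is attained after multiplication by a rank-one contraction. -/
theorem exists_opNorm_le_one_opNorm_mul_eq [Nonempty ι] (a : Matrix κ μ ℂ) :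
    ∃ b : Matrix ι κ ℂ, opNorm q r b ≤ 1 ∧ opNorm p r (b * a) = opNorm p q a := by
  classical
  obtain ⟨x, hx, hax⟩ := (a.toLpCLM p q).exists_norm_le_one_norm_apply_eq
  obtain ⟨f, hf, hfx⟩ := exists_dual_vector'' ℂ (a.toLpCLM p q x)
  let i : ι := Classical.arbitrary ι
  let e : PiLp r (fun _ : ι => ℂ) := WithLp.toLp r (Pi.single i 1)
  have he : ‖e‖ = 1 := by simp [e]
  obtain ⟨b, hb⟩ := Matrix.exists_toLpCLM_eq (f.smulRight e)
  have hb1 : opNorm q r b ≤ 1 := by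
    rw [opNorm_eq_norm_toLpCLM, hb, ContinuousLinearMap.norm_smulRight_apply, he, mul_one]
    exact hf
  refine ⟨b, hb1, le_antisymm ?_ ?_⟩
  · exact (opNorm_mul_le b a).trans (mul_le_of_le_one_left (norm_nonneg _) hb1)
  · calc opNorm p q a = ‖(b * a).toLpCLM p r x‖ := by
          rw [Matrix.toLpCLM_mul (q := q), hb, ContinuousLinearMap.comp_apply,
            ContinuousLinearMap.smulRight_apply, hfx, norm_smul, he, hax]
          simp [opNorm_eq_norm_toLpCLM]
      _ ≤ opNorm p r (b * a) := ContinuousLinearMap.unit_le_opNorm _ x hx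

end

theorem stmt_2 (p : ℝ≥0∞) [Fact (1 ≤ p)] (hp : p ≠ ∞)
    (n d : ℕ) (hn : 0 < n) (hd : 0 < d)
    (A : Matrix (Fin (n * d)) (Fin d) ℂ) :
    IsGreatest
      {r : ℝ | ∃ b : Matrix (Fin d) (Fin (n * d)) ℂ,
        opNorm p p b ≤ 1 ∧ r = opNorm p p (b * A)}
      (opNorm p p A) := by
  have : Nonempty (Fin d) := ⟨⟨0, hd⟩⟩
  refine ⟨?_, ?_⟩
  · obtain ⟨b, hb, hbA⟩ := exists_opNorm_le_one_opNorm_mul_eq (p := p) (q := p) (r := p)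
      (ι := Fin d) A
    exact ⟨b, hb, hbA.symm⟩
  · rintro _ ⟨b, hb, rfl⟩
    exact (opNorm_mul_le b A).trans (mul_le_of_le_one_left (norm_nonneg _) hb)
end

section
/- Let p ∈ [1, ∞), let n, d ≥ 1 be integers, and let 𝐚 be a complex (nd)×d matrix. Then there exists η ∈ ℂ^{nd} with ‖η‖_{p'} ≤ 1 (p' the Hölder conjugate of p) such that the p-operator norm of 𝐚 equals the p-operator norm of the d×d matrix b_η 𝐚, where b_η is the d×(nd) matrix whose first row is ηᵀ and whose other rows are zero. -/
open scoped ENNReal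

theorem PiLp.norm_sum_mul_le {ι : Type*} [Fintype ι] (p q : ℝ≥0∞) [Fact (1 ≤ p)]
    [Fact (1 ≤ q)] (hp : p ≠ ∞) (hpq : 1 / p + 1 / q = 1)
    (x : PiLp p fun _ : ι => ℂ) (y : PiLp q fun _ : ι => ℂ) :
    ‖∑ i, y i * x i‖ ≤ ‖y‖ * ‖x‖ := by
  have : ENNReal.HolderConjugate p q := ⟨by simpa using hpq⟩
  refine (norm_sum_le _ _).trans ?_
  simp only [norm_mul]
  by_cases hq : q = ∞
  · subst hq
    obtain rfl : p = 1 := by simpa using hpq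
    rw [PiLp.norm_eq_of_L1, Finset.mul_sum]
    gcongr with i
    exact PiLp.norm_apply_le y i
  · have h := ENNReal.HolderConjugate.toReal_of_ne_top hp hq
    rw [PiLp.norm_eq_sum h.pos, PiLp.norm_eq_sum h.symm.pos]
    exact Real.inner_le_Lp_mul_Lq_of_nonneg _ h.symm (fun _ _ => norm_nonneg _)
      (fun _ _ => norm_nonneg _)

theorem PiLp.exists_norm_le_one_sum_mul_eq_norm {ι : Type*} [Fintype ι] (p q : ℝ≥0∞)
    [Fact (1 ≤ p)] [Fact (1 ≤ q)] (hp : p ≠ ∞) (hpq : 1 / p + 1 / q = 1)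
    (x : PiLp p fun _ : ι => ℂ) :
    ∃ y : PiLp q fun _ : ι => ℂ, ‖y‖ ≤ 1 ∧ ∑ i, y i * x i = (‖x‖ : ℂ) := by
  have : ENNReal.HolderConjugate p q := ⟨by simpa using hpq⟩
  choose u hu hux using fun i => RCLike.exists_norm_eq_mul_self (x i)
  by_cases hq : q = ∞
  · subst hq
    obtain rfl : p = 1 := by simpa using hpq
    refine ⟨WithLp.toLp _ u, ?_, ?_⟩
    · rw [PiLp.norm_eq_ciSup]
      exact Real.iSup_le (fun i => (hu i).le) zero_le_one
    · rw [PiLp.norm_eq_of_L1]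
      push_cast
      exact Finset.sum_congr rfl fun i _ => (hux i).symm
  · have h := ENNReal.HolderConjugate.toReal_of_ne_top hp hq
    obtain ⟨g, hg, hgx⟩ := (NNReal.isGreatest_Lp Finset.univ (fun i => ‖x i‖₊) h).1
    refine ⟨WithLp.toLp _ fun i => (g i : ℂ) * u i, ?_, ?_⟩
    · rw [PiLp.norm_eq_sum h.symm.pos]
      refine Real.rpow_le_one (by positivity) ?_ (by have := h.symm.pos; positivity)
      simpa [hu] using (NNReal.coe_le_coe.2 hg)
    · rw [PiLp.norm_eq_sum h.pos]
      have hgx' := congrArg (fun r : NNReal => ((r : ℝ) : ℂ)) hgx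
      push_cast at hgx' ⊢
      refine Eq.trans (Finset.sum_congr rfl fun i _ => ?_) (hgx'.trans ?_)
      · rw [mul_assoc, ← hux i, mul_comm]; rfl
      · norm_cast

theorem ContinuousLinearMap.exists_norm_le_one_norm_apply_eq_opNorm {E F : Type*}
    [NormedAddCommGroup E] [NormedSpace ℂ E] [FiniteDimensional ℂ E]
    [NormedAddCommGroup F] [NormedSpace ℂ F] (f : E →L[ℂ] F) :
    ∃ x, ‖x‖ ≤ 1 ∧ ‖f x‖ = ‖f‖ := by
  have : ProperSpace E := FiniteDimensional.proper ℂ E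
  obtain ⟨x, hx, h⟩ := (isCompact_closedBall (0 : E) 1).exists_sSup_image_eq
    ⟨0, by simp⟩ (f := fun x => ‖f x‖) (by fun_prop)
  exact ⟨x, by simpa using hx, h.symm.trans f.sSup_unitClosedBall_eq_norm⟩

theorem stmt_6 (p p' : ℝ≥0∞) [Fact (1 ≤ p)] [Fact (1 ≤ p')] (hp : p ≠ ∞)
    (hp' : 1 / p + 1 / p' = 1)
    (n d : ℕ) (hn : 0 < n) (hd : 0 < d)
    (A : Matrix (Fin (n * d)) (Fin d) ℂ) :
    ∃ η : Fin (n * d) → ℂ,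
      ‖(WithLp.equiv p' (Fin (n * d) → ℂ)).symm η‖ ≤ 1 ∧
      opNorm p p A =
        opNorm p p ((Matrix.of fun (i : Fin d) (j : Fin (n * d)) =>
          if i = ⟨0, hd⟩ then η j else 0) * A) := by
  unfold opNorm
  set T := LinearMap.toContinuousLinearMap
    (((WithLp.linearEquiv p ℂ (Fin (n * d) → ℂ)).symm.toLinearMap.comp
      A.mulVecLin).comp (WithLp.linearEquiv p ℂ (Fin d → ℂ)).toLinearMap) with hT
  obtain ⟨x, hx, hTx⟩ := T.exists_norm_le_one_norm_apply_eq_opNorm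
  obtain ⟨y, hy, hyx⟩ := PiLp.exists_norm_le_one_sum_mul_eq_norm p p' hp hp' (T x)
  refine ⟨WithLp.ofLp y, hy, ?_⟩
  set S := LinearMap.toContinuousLinearMap
    (((WithLp.linearEquiv p ℂ (Fin d → ℂ)).symm.toLinearMap.comp
      (((Matrix.of fun (i : Fin d) (j : Fin (n * d)) =>
          if i = ⟨0, hd⟩ then y j else 0) * A)).mulVecLin).comp
      (WithLp.linearEquiv p ℂ (Fin d → ℂ)).toLinearMap) with hS
  have key (z) : ‖S z‖ = ‖∑ j, y j * T z j‖ := by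
    have : S z = PiLp.single p ⟨0, hd⟩ (∑ j, y j * T z j) := by
      ext i
      have hSz : S z i = ((Matrix.of fun (i : Fin d) (j : Fin (n * d)) =>
          if i = ⟨0, hd⟩ then y j else 0).mulVec (A.mulVec (WithLp.ofLp z))) i := by
        rw [Matrix.mulVec_mulVec]
        rfl
      rw [hSz]
      by_cases hi : i = ⟨0, hd⟩
      · subst hi
        simp [hT, Matrix.mulVec, dotProduct]
      · simp [Matrix.mulVec, dotProduct, hi]
    rw [this, PiLp.norm_single]
  apply le_antisymm
  · calc ‖T‖ = ‖S x‖ := by rw [key, hyx, ← hTx]; simp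
      _ ≤ ‖S‖ * ‖x‖ := S.le_opNorm x
      _ ≤ ‖S‖ := mul_le_of_le_one_right (norm_nonneg _) hx
  · refine S.opNorm_le_bound (norm_nonneg _) fun z => ?_
    calc ‖S z‖ ≤ ‖y‖ * ‖T z‖ := key z ▸ PiLp.norm_sum_mul_le p p' hp hp' (T z) y
      _ ≤ ‖T z‖ := mul_le_of_le_one_left (norm_nonneg _) hy
      _ ≤ ‖T‖ * ‖z‖ := T.le_opNorm z
end

section
/- Let u = (1/√2)·[[1, 1], [1, −1]] (the normalized 2×2 Hadamard matrix), and let A = {u · diag(λ₁, λ₂) · u⁻¹ : λ₁, λ₂ ∈ ℂ} ⊆ M_2(ℂ). Let a₁ = u · diag(2, 1) · u⁻¹ and a₂ = u · diag(1, 2) · u⁻¹, and let 𝐚 be the 4×2 matrix obtained by stacking a₁ above a₂. Then: (i) the 1-operator norm of 𝐚 equals 4; (ii) the supremum, over all 2×4 matrices 𝐛 = [b₁ b₂] with b₁, b₂ ∈ A and with 1-operator norm of 𝐛 at most 1, of the 1-operator norm of the 2×2 matrix 𝐛𝐚 equals √10; in particular this supremum is strictly less than ‖𝐚‖₁, so the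 first C*-likeness condition fails for the row-column module (M¹_{1,2}(A), M¹_{2,1}(A)). -/
open scoped ENNReal

/-- The normalized 2×2 Hadamard matrix. -/
noncomputable def hadamard2 : Matrix (Fin 2) (Fin 2) ℂ :=
  (((Real.sqrt 2)⁻¹ : ℝ) : ℂ) • !![1, 1; 1, -1]

/-- Membership in the algebra of matrices simultaneously diagonalized by the
columns of the normalized Hadamard matrix. -/
def memA (m : Matrix (Fin 2) (Fin 2) ℂ) : Prop :=
  ∃ l1 l2 : ℂ, m = hadamard2 * Matrix.diagonal ![l1, l2] * hadamard2⁻¹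

noncomputable def a1 : Matrix (Fin 2) (Fin 2) ℂ :=
  hadamard2 * Matrix.diagonal ![2, 1] * hadamard2⁻¹

noncomputable def a2 : Matrix (Fin 2) (Fin 2) ℂ :=
  hadamard2 * Matrix.diagonal ![1, 2] * hadamard2⁻¹

/-- The 4×2 matrix obtained by stacking `a1` above `a2`. -/
noncomputable def bigA : Matrix (Fin 2 × Fin 2) (Fin 2) ℂ :=
  Matrix.of fun x t => (if x.1 = 0 then a1 else a2) x.2 t

/-- The 2×4 matrix obtained by horizontally concatenating `b1` and `b2`. -/
def hcat2 (b1 b2 : Matrix (Fin 2) (Fin 2) ℂ) : Matrix (Fin 2) (Fin 2 × Fin 2) ℂ :=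
  Matrix.of fun s c => (if c.1 = 0 then b1 else b2) s c.2

theorem norm_toLp_one {ι : Type*} [Fintype ι] (x : ι → ℂ) :
    ‖WithLp.toLp 1 x‖ = ∑ i, ‖x i‖ := by
  simp [PiLp.norm_eq_of_L1]

theorem sum_norm_col_le_opNorm {ι κ : Type*} [Fintype ι] [Fintype κ]
    (a : Matrix ι κ ℂ) (j : κ) : ∑ i, ‖a i j‖ ≤ opNorm 1 1 a := by
  classical
  have h := (LinearMap.toContinuousLinearMap
    (((WithLp.linearEquiv 1 ℂ (ι → ℂ)).symm.toLinearMap.comp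
      a.mulVecLin).comp (WithLp.linearEquiv 1 ℂ (κ → ℂ)).toLinearMap)).le_opNorm
        (WithLp.toLp 1 (Pi.single j 1))
  simpa [opNorm, norm_toLp_one, Pi.single_apply, apply_ite norm] using h

theorem opNorm_one_le {ι κ : Type*} [Fintype ι] [Fintype κ] (a : Matrix ι κ ℂ) {C : ℝ}
    (hC : 0 ≤ C) (h : ∀ j, ∑ i, ‖a i j‖ ≤ C) : opNorm 1 1 a ≤ C := by
  refine ContinuousLinearMap.opNorm_le_bound _ hC fun x => ?_
  have hx : ‖x‖ = ∑ j, ‖x j‖ := norm_toLp_one x.ofLp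
  refine (norm_toLp_one (a.mulVec x.ofLp)).trans_le ?_
  calc ∑ i, ‖a.mulVec x.ofLp i‖ ≤ ∑ i, ∑ j, ‖a i j‖ * ‖x j‖ :=
        Finset.sum_le_sum fun i _ =>
          (norm_sum_le _ _).trans_eq (Finset.sum_congr rfl fun j _ => norm_mul _ _)
    _ = ∑ j, (∑ i, ‖a i j‖) * ‖x j‖ := by
        rw [Finset.sum_comm]; simp only [Finset.sum_mul]
    _ ≤ ∑ j, C * ‖x j‖ :=
        Finset.sum_le_sum fun j _ => mul_le_mul_of_nonneg_right (h j) (norm_nonneg _)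
    _ = C * ‖x‖ := by rw [hx, Finset.mul_sum]

theorem inv_sqrt_two_mul_self :
    (((Real.sqrt 2)⁻¹ : ℝ) : ℂ) * (((Real.sqrt 2)⁻¹ : ℝ) : ℂ) = 1 / 2 := by
  rw [← Complex.ofReal_mul, ← mul_inv, Real.mul_self_sqrt (by norm_num)]
  norm_num

theorem hadamard2_mul_self : hadamard2 * hadamard2 = 1 := by
  rw [hadamard2, Matrix.smul_mul, Matrix.mul_smul, smul_smul, inv_sqrt_two_mul_self]
  ext i j
  fin_cases i <;> fin_cases j <;> norm_num [Matrix.mul_apply, Fin.sum_univ_two]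

theorem hadamard2_conj_diagonal (l1 l2 : ℂ) :
    hadamard2 * Matrix.diagonal ![l1, l2] * hadamard2⁻¹ =
      !![(l1 + l2) / 2, (l1 - l2) / 2; (l1 - l2) / 2, (l1 + l2) / 2] := by
  rw [Matrix.inv_eq_right_inv hadamard2_mul_self, hadamard2, Matrix.smul_mul, Matrix.smul_mul,
    Matrix.mul_smul, smul_smul, inv_sqrt_two_mul_self]
  ext i j
  fin_cases i <;> fin_cases j <;>
    simp [Matrix.vecMul, dotProduct, Matrix.mul_apply, Fin.sum_univ_two,
      Matrix.diagonal_apply] <;> ring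

theorem memA_iff (m : Matrix (Fin 2) (Fin 2) ℂ) : memA m ↔ ∃ p q : ℂ, m = !![p, q; q, p] := by
  constructor
  · rintro ⟨l1, l2, rfl⟩
    exact ⟨_, _, hadamard2_conj_diagonal l1 l2⟩
  · rintro ⟨p, q, rfl⟩
    refine ⟨p + q, p - q, ?_⟩
    rw [hadamard2_conj_diagonal]
    congr! <;> ring

theorem a1_eq : a1 = !![3 / 2, 1 / 2; 1 / 2, 3 / 2] := by
  rw [a1, hadamard2_conj_diagonal]; norm_num

theorem a2_eq : a2 = !![3 / 2, -1 / 2; -1 / 2, 3 / 2] := by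
  rw [a2, hadamard2_conj_diagonal]; norm_num

theorem opNorm_bigA : opNorm 1 1 bigA = 4 := by
  have hcol (j : Fin 2) : ∑ i, ‖bigA i j‖ = 4 := by
    fin_cases j <;>
      norm_num [bigA, a1_eq, a2_eq, Fintype.sum_prod_type, Fin.sum_univ_two]
  exact le_antisymm (opNorm_one_le _ (by norm_num) fun j => (hcol j).le)
    ((hcol 0).symm.trans_le (sum_norm_col_le_opNorm _ 0))

theorem hcat2_mul_bigA (p q r s : ℂ) :
    hcat2 !![p, q; q, p] !![r, s; s, r] * bigA =
      !![(3 * p + q + 3 * r - s) / 2, (p + 3 * q + 3 * s - r) / 2;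
        (p + 3 * q + 3 * s - r) / 2, (3 * p + q + 3 * r - s) / 2] := by
  ext i j
  fin_cases i <;> fin_cases j <;>
    simp [Matrix.mul_apply, hcat2, bigA, a1_eq, a2_eq, Fintype.sum_prod_type,
      Fin.sum_univ_two] <;> ring

theorem opNorm_circulant (x y : ℂ) : opNorm 1 1 !![x, y; y, x] = ‖x‖ + ‖y‖ := by
  have hcol (j : Fin 2) : ∑ i, ‖!![x, y; y, x] i j‖ = ‖x‖ + ‖y‖ := by
    fin_cases j <;> simp [Fin.sum_univ_two, add_comm]
  exact le_antisymm (opNorm_one_le _ (by positivity) fun j => (hcol j).le)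
    ((hcol 0).symm.trans_le (sum_norm_col_le_opNorm _ 0))

theorem opNorm_hcat2_circulant_le_one_iff (p q r s : ℂ) :
    opNorm 1 1 (hcat2 !![p, q; q, p] !![r, s; s, r]) ≤ 1 ↔
      ‖p‖ + ‖q‖ ≤ 1 ∧ ‖r‖ + ‖s‖ ≤ 1 := by
  constructor
  · intro h
    have h0 := (sum_norm_col_le_opNorm _ (0, 0)).trans h
    have h1 := (sum_norm_col_le_opNorm _ (1, 0)).trans h
    simp [hcat2, Fin.sum_univ_two] at h0 h1
    exact ⟨h0, h1⟩
  · rintro ⟨h0, h1⟩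
    refine opNorm_one_le _ zero_le_one ?_
    rintro ⟨i, j⟩
    fin_cases i <;> fin_cases j <;> simp [hcat2, Fin.sum_univ_two] <;> linarith

theorem norm_add_norm_le_of_unit {e d : ℂ} (he : ‖e‖ = 1) (hd : ‖d‖ = 1) :
    ‖3 * e + d‖ = ‖e + 3 * d‖ ∧ ‖3 * e - d‖ = ‖3 * d - e‖ ∧
      ‖3 * e + d‖ + ‖3 * e - d‖ ≤ 2 * Real.sqrt 10 := by
  have he2 : e.re * e.re + e.im * e.im = 1 := by
    rw [← Complex.normSq_apply, Complex.normSq_eq_norm_sq, he, one_pow]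
  have hd2 : d.re * d.re + d.im * d.im = 1 := by
    rw [← Complex.normSq_apply, Complex.normSq_eq_norm_sq, hd, one_pow]
  have key : ‖3 * e + d‖ ^ 2 + ‖3 * e - d‖ ^ 2 = 20 := by
    simp only [← Complex.normSq_eq_norm_sq, Complex.normSq_apply]
    simp
    linear_combination 18 * he2 + 2 * hd2
  refine ⟨?_, ?_, ?_⟩
  · rw [← sq_eq_sq₀ (norm_nonneg _) (norm_nonneg _)]
    simp only [← Complex.normSq_eq_norm_sq, Complex.normSq_apply]
    simp
    linear_combination 8 * he2 - 8 * hd2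
  · rw [← sq_eq_sq₀ (norm_nonneg _) (norm_nonneg _)]
    simp only [← Complex.normSq_eq_norm_sq, Complex.normSq_apply]
    simp
    linear_combination 8 * he2 - 8 * hd2
  · refine abs_le_of_sq_le_sq' ?_ (by positivity) |>.2
    rw [mul_pow, Real.sq_sqrt (by norm_num)]
    nlinarith [sq_nonneg (‖3 * e + d‖ - ‖3 * e - d‖)]

theorem norm_add_norm_le_two_mul_sqrt_ten {p q r s : ℂ} (hpq : ‖p‖ + ‖q‖ ≤ 1)
    (hrs : ‖r‖ + ‖s‖ ≤ 1) :
    ‖3 * p + q + 3 * r - s‖ + ‖p + 3 * q + 3 * s - r‖ ≤ 2 * Real.sqrt 10 := by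
  obtain ⟨e, he, hex⟩ := RCLike.exists_norm_eq_mul_self (3 * p + q + 3 * r - s)
  obtain ⟨d, hd, hdy⟩ := RCLike.exists_norm_eq_mul_self (p + 3 * q + 3 * s - r)
  obtain ⟨h1, h2, h3⟩ := norm_add_norm_le_of_unit he hd
  have hsum : ((‖3 * p + q + 3 * r - s‖ + ‖p + 3 * q + 3 * s - r‖ : ℝ) : ℂ) =
      p * (3 * e + d) + q * (e + 3 * d) + (r * (3 * e - d) + s * (3 * d - e)) := by
    rw [Complex.ofReal_add]
    refine (congrArg₂ (· + ·) hex hdy).trans ?_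
    ring
  have hnorm := congrArg norm hsum
  rw [Complex.norm_of_nonneg (by positivity)] at hnorm
  rw [hnorm]
  calc _ ≤ (‖p‖ * ‖3 * e + d‖ + ‖q‖ * ‖e + 3 * d‖) +
        (‖r‖ * ‖3 * e - d‖ + ‖s‖ * ‖3 * d - e‖) := by
        simp only [← norm_mul]
        exact (norm_add_le _ _).trans (add_le_add (norm_add_le _ _) (norm_add_le _ _))
    _ = (‖p‖ + ‖q‖) * ‖3 * e + d‖ + (‖r‖ + ‖s‖) * ‖3 * e - d‖ := by
        rw [← h1, ← h2]; ring
    _ ≤ 1 * ‖3 * e + d‖ + 1 * ‖3 * e - d‖ := by gcongr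
    _ ≤ 2 * Real.sqrt 10 := by linarith

theorem isGreatest_opNorm_hcat2_mul_bigA :
    IsGreatest {r : ℝ | ∃ b1 b2 : Matrix (Fin 2) (Fin 2) ℂ, memA b1 ∧ memA b2 ∧
        opNorm 1 1 (hcat2 b1 b2) ≤ 1 ∧
        r = opNorm 1 1 (hcat2 b1 b2 * bigA)} (Real.sqrt 10) := by
  constructor
  · refine ⟨!![1, 0; 0, 1], !![0, Complex.I; Complex.I, 0], (memA_iff _).2 ⟨_, _, rfl⟩,
      (memA_iff _).2 ⟨_, _, rfl⟩, (opNorm_hcat2_circulant_le_one_iff _ _ _ _).2 (by simp), ?_⟩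
    rw [hcat2_mul_bigA, opNorm_circulant]
    have h1 : ‖(3 - Complex.I : ℂ)‖ = Real.sqrt 10 := by
      rw [Complex.norm_def, Complex.normSq_apply]; norm_num
    have h2 : ‖(1 + 3 * Complex.I : ℂ)‖ = Real.sqrt 10 := by
      rw [Complex.norm_def, Complex.normSq_apply]; norm_num
    simp [h1, h2]
  · rintro _ ⟨b1, b2, hb1, hb2, hb, rfl⟩
    obtain ⟨p, q, rfl⟩ := (memA_iff _).1 hb1
    obtain ⟨r, s, rfl⟩ := (memA_iff _).1 hb2
    obtain ⟨hpq, hrs⟩ := (opNorm_hcat2_circulant_le_one_iff _ _ _ _).1 hb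
    rw [hcat2_mul_bigA, opNorm_circulant, norm_div, norm_div, Complex.norm_ofNat]
    linarith [norm_add_norm_le_two_mul_sqrt_ten hpq hrs]

theorem stmt_16 :
    opNorm 1 1 bigA = 4 ∧
    sSup {r : ℝ | ∃ b1 b2 : Matrix (Fin 2) (Fin 2) ℂ, memA b1 ∧ memA b2 ∧
        opNorm 1 1 (hcat2 b1 b2) ≤ 1 ∧
        r = opNorm 1 1 (hcat2 b1 b2 * bigA)} = Real.sqrt 10 ∧
    sSup {r : ℝ | ∃ b1 b2 : Matrix (Fin 2) (Fin 2) ℂ, memA b1 ∧ memA b2 ∧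
        opNorm 1 1 (hcat2 b1 b2) ≤ 1 ∧
        r = opNorm 1 1 (hcat2 b1 b2 * bigA)} < opNorm 1 1 bigA := by
  rw [isGreatest_opNorm_hcat2_mul_bigA.csSup_eq, opNorm_bigA]
  exact ⟨rfl, rfl, (Real.sqrt_lt' (by norm_num)).2 (by norm_num)⟩
end
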